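/- arXiv:1911.00658 — 5 statements merged into one kernel-verified Lean document; each statement's English description precedes it below -/
import Mathlib

section
/- Consider the scalar GAGA recursion at a coordinate whose true coefficient is zero. For each sample size n let α_n satisfy the rate condition α ≍ √(log n), let Z_n be a real Gaussian random variable with mean 0 and variance n σ* (σ* > 0), and define b_{n,0} = 0, b_{n,k+1} = α_n (n σ* + b_{n,k})² / (Z_n² + n σ* + b_{n,k}). For an iteration count K set b*_{n,K} = b_{n,K}/α_n and β̂*_{n,K} = Z_n/(n σ* + b*_{n,K}), set to 0 when the hard truncation condition (β̂*_{n,K})² < 1/(n σ*) − 1/(n σ* + b*_{n,K}) holds. Then for any δ > 0, for all sufficiently large n there exists a positive integer k(n, δ) such that for every iteration number K > k(n, δ), P(β̂*_{n,K} = 0) > 1 − δ. -/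
open MeasureTheory ProbabilityTheory Filter
open scoped ENNReal NNReal

/-- The scalar GAGA hyperparameter recursion: `b₀ = 0`,
`b_{k+1} = α (σ + b_k)² / (z² + σ + b_k)`. -/
noncomputable def gagaB (α σ z : ℝ) : ℕ → ℝ
  | 0 => 0
  | k + 1 => α * (σ + gagaB α σ z k) ^ 2 / (z ^ 2 + σ + gagaB α σ z k)

/-- The GAGA estimate after `K` iterations: `b* = b_K / α`, `β̂* = z / (σ + b*)`,
hard-truncated to `0` when `(β̂*)² < 1/σ − 1/(σ + b*)`. -/
noncomputable def gagaEst (α σ z : ℝ) (K : ℕ) : ℝ :=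
  if (z / (σ + gagaB α σ z K / α)) ^ 2 < 1 / σ - 1 / (σ + gagaB α σ z K / α) then 0
  else z / (σ + gagaB α σ z K / α)

lemma two_pow_mul_le_add_gagaB {α σ z M : ℝ} (hσ : 0 < σ) (hM : 0 < M)
    (hα : 2 * (1 + M) ≤ α) (hz : z ^ 2 ≤ M * σ) (k : ℕ) :
    2 ^ k * σ ≤ σ + gagaB α σ z k := by
  induction k with
  | zero => simp [gagaB]
  | succ k ih =>
    have hk : σ ≤ σ + gagaB α σ z k :=
      le_trans (le_mul_of_one_le_left hσ.le (one_le_pow₀ one_le_two)) ih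
    rw [gagaB, add_assoc]
    set s := σ + gagaB α σ z k
    have hs : 0 < s := hσ.trans_le hk
    have hzs : z ^ 2 + s ≤ (1 + M) * s := by nlinarith
    have key : 2 * s ≤ α * s ^ 2 / (z ^ 2 + s) := by
      rw [le_div_iff₀ (by positivity)]
      calc 2 * s * (z ^ 2 + s) ≤ 2 * s * ((1 + M) * s) := by gcongr
        _ = 2 * (1 + M) * s ^ 2 := by ring
        _ ≤ α * s ^ 2 := by gcongr
    rw [pow_succ]
    linarith

lemma gagaEst_eq_zero_of_sq_le {α σ z M : ℝ} {K : ℕ} (hσ : 0 < σ) (hM : 0 < M)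
    (hα : 2 * (1 + M) ≤ α) (hz : z ^ 2 ≤ M * σ) (hK : 1 + α * (M + 1) ≤ 2 ^ K) :
    gagaEst α σ z K = 0 := by
  have hα0 : 0 < α := by linarith
  have hb : (M + 1) * σ ≤ gagaB α σ z K / α := by
    rw [le_div_iff₀ hα0]
    nlinarith [two_pow_mul_le_add_gagaB hσ hM hα hz K, mul_le_mul_of_nonneg_right hK hσ.le]
  rw [gagaEst, if_pos]
  set b := gagaB α σ z K / α
  have hσb : σ < b := by nlinarith
  have hs : 0 < σ + b := by linarith
  have hdiff : 1 / σ - 1 / (σ + b) = b * (σ + b) / σ / (σ + b) ^ 2 := by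
    field_simp
    ring
  rw [hdiff, div_pow]
  refine div_lt_div_of_pos_right ?_ (by positivity)
  rw [lt_div_iff₀ hσ]
  nlinarith [mul_le_mul_of_nonneg_right hz hσ.le, mul_le_mul_of_nonneg_right hb hσ.le,
    mul_pos hσ hσ, mul_pos hσ (hσ.trans hσb)]

lemma gaussianReal_sq_ge_le {v : ℝ≥0} (hv : 0 < v) {M : ℝ} (hM : 0 < M) :
    gaussianReal 0 v {x | M * v ≤ x ^ 2} ≤ ENNReal.ofReal (1 / M) := by
  have hMv : 0 < M * (v : ℝ) := by positivity
  have h := meas_ge_le_variance_div_sq (μ := gaussianReal 0 v) (X := id)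
    (memLp_id_gaussianReal 2) (Real.sqrt_pos.2 hMv)
  rw [variance_id_gaussianReal, Real.sq_sqrt hMv.le] at h
  have hdiv : (v : ℝ) / (M * v) = 1 / M := by
    have : (v : ℝ) ≠ 0 := by positivity
    field_simp
  rw [hdiv] at h
  refine (measure_mono fun x hx => ?_).trans h
  simpa using Real.sqrt_le_sqrt (show M * (v : ℝ) ≤ x ^ 2 from hx) |>.trans_eq
    (Real.sqrt_sq_eq_abs x)

/-- At a coordinate whose true coefficient is zero, with `α ≍ √(log n)`,
the GAGA output is exactly zero with probability at least `1 − δ` for all large `n`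
and all large enough iteration counts `K`. -/
theorem gaga_zero_coefficient_truncated
    {Ω : Type*} [MeasurableSpace Ω] (P : Measure Ω) [IsProbabilityMeasure P]
    (σs : ℝ) (hσ : 0 < σs)
    (α : ℕ → ℝ) (c₁ c₂ : ℝ) (hc₁ : 0 < c₁) (hc₂ : 0 < c₂)
    (hα : ∀ n : ℕ, 2 ≤ n →
      c₁ * Real.sqrt (Real.log n) ≤ α n ∧ α n ≤ c₂ * Real.sqrt (Real.log n))
    (Z : ℕ → Ω → ℝ) (hZmeas : ∀ n, Measurable (Z n))
    (hZ : ∀ n : ℕ, P.map (Z n) = gaussianReal 0 ((n : ℝ) * σs).toNNReal)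
    (δ : ℝ) (hδ : 0 < δ) :
    ∃ N : ℕ, ∀ n ≥ N, ∃ k₀ : ℕ, 0 < k₀ ∧ ∀ K : ℕ, k₀ < K →
      (P {ω | gagaEst (α n) ((n : ℝ) * σs) (Z n ω) K = 0}).toReal > 1 - δ := by
  set M : ℝ := 2 / δ with hMdef
  have hM : 0 < M := by positivity
  have hlim : Tendsto (fun n : ℕ => c₁ * Real.sqrt (Real.log n)) atTop atTop :=
    (Real.tendsto_sqrt_atTop.comp
      (Real.tendsto_log_atTop.comp tendsto_natCast_atTop_atTop)).const_mul_atTop hc₁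
  obtain ⟨N, hN⟩ := eventually_atTop.1
    ((hlim.eventually_ge_atTop (2 * (1 + M))).and (eventually_ge_atTop 2))
  refine ⟨N, fun n hn => ?_⟩
  obtain ⟨hn₁, hn₂⟩ := hN n hn
  have hαn : 2 * (1 + M) ≤ α n := hn₁.trans (hα n hn₂).1
  have hσn : 0 < (n : ℝ) * σs := by
    have : (0 : ℝ) < n := by exact_mod_cast (by omega : 0 < n)
    positivity
  obtain ⟨k, hk⟩ := pow_unbounded_of_one_lt (1 + α n * (M + 1)) (one_lt_two (α := ℝ))
  refine ⟨k + 1, k.succ_pos, fun K hK => ?_⟩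
  have hKpow : 1 + α n * (M + 1) ≤ 2 ^ K :=
    hk.le.trans (pow_le_pow_right₀ one_le_two (by omega))
  set B : Set ℝ := {x | M * (n * σs) ≤ x ^ 2}
  have hB : MeasurableSet B := measurableSet_le measurable_const (measurable_id.pow_const 2)
  have hPB : P.real (Z n ⁻¹' B) ≤ δ / 2 := by
    have h := gaussianReal_sq_ge_le (Real.toNNReal_pos.2 hσn) hM
    rw [Real.coe_toNNReal _ hσn.le, ← hZ n, Measure.map_apply (hZmeas n) hB] at h
    have h' := ENNReal.toReal_le_of_le_ofReal (by positivity) h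
    rwa [hMdef, one_div_div] at h'
  have hcompl := probReal_compl_eq_one_sub (μ := P) (hZmeas n hB)
  have hmono : P.real (Z n ⁻¹' B)ᶜ ≤
      P.real {ω | gagaEst (α n) ((n : ℝ) * σs) (Z n ω) K = 0} :=
    measureReal_mono fun ω hω =>
      gagaEst_eq_zero_of_sq_le hσn hM hαn (le_of_not_ge hω) hKpow
  change P.real _ > 1 - δ
  linarith
end

section
/- For any α > 0, σ > 0 and z ∈ ℝ, if the GAGA update map f(b) = α(σ+b)²/(z² + σ + b) has at least one fixed point in [0, ∞), then the GAGA hyperparameter sequence b_0 = 0, b_{k+1} = f(b_k) converges as k → ∞ to the least fixed point of f in [0, ∞) (which is strictly positive). -/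
open Filter
open scoped Topology

theorem gaga_update_mono {α σ z x y : ℝ} (hα : 0 < α) (hσ : 0 < σ) (hx : 0 ≤ x) (hxy : x ≤ y) :
    α * (σ + x) ^ 2 / (z ^ 2 + σ + x) ≤ α * (σ + y) ^ 2 / (z ^ 2 + σ + y) := by
  have hy : 0 ≤ y := hx.trans hxy
  rw [div_le_div_iff₀ (by positivity) (by positivity), mul_assoc, mul_assoc]
  refine mul_le_mul_of_nonneg_left ?_ hα.le
  have h₁ : 0 ≤ (σ + x) * (σ + y) * (y - x) :=
    mul_nonneg (by positivity) (sub_nonneg.mpr hxy)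
  have h₂ : 0 ≤ z ^ 2 * ((y - x) * ((σ + x) + (σ + y))) :=
    mul_nonneg (sq_nonneg z) (mul_nonneg (sub_nonneg.mpr hxy) (by positivity))
  linarith

theorem gagaB_nonneg {α σ z : ℝ} (hα : 0 < α) (hσ : 0 < σ) (k : ℕ) : 0 ≤ gagaB α σ z k := by
  induction k with
  | zero => exact le_rfl
  | succ k ih =>
    rw [gagaB]
    positivity

theorem gagaB_monotone {α σ z : ℝ} (hα : 0 < α) (hσ : 0 < σ) : Monotone (gagaB α σ z) := by
  refine monotone_nat_of_le_succ fun k => ?_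
  induction k with
  | zero => exact gagaB_nonneg hα hσ 1
  | succ k ih => exact gaga_update_mono hα hσ (gagaB_nonneg hα hσ k) ih

theorem gagaB_le_of_fixed_point {α σ z b : ℝ} (hα : 0 < α) (hσ : 0 < σ) (hb : 0 ≤ b)
    (hfix : α * (σ + b) ^ 2 / (z ^ 2 + σ + b) = b) (k : ℕ) : gagaB α σ z k ≤ b := by
  induction k with
  | zero => exact hb
  | succ k ih => exact (gaga_update_mono hα hσ (gagaB_nonneg hα hσ k) ih).trans_eq hfix

/-- If the GAGA update map has a fixed point in `[0, ∞)`, then the GAGA hyperparameter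
sequence converges to the least such fixed point, which is strictly positive. -/
theorem gaga_converges_to_least_fixed_point (α σ z : ℝ) (hα : 0 < α) (hσ : 0 < σ)
    (hfix : ∃ b : ℝ, 0 ≤ b ∧ α * (σ + b) ^ 2 / (z ^ 2 + σ + b) = b) :
    ∃ L : ℝ,
      IsLeast {b : ℝ | 0 ≤ b ∧ α * (σ + b) ^ 2 / (z ^ 2 + σ + b) = b} L ∧
      0 < L ∧ Tendsto (gagaB α σ z) atTop (𝓝 L) := by
  obtain ⟨b, hb, hfb⟩ := hfix
  have hbdd : BddAbove (Set.range (gagaB α σ z)) :=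
    ⟨b, Set.forall_mem_range.mpr (gagaB_le_of_fixed_point hα hσ hb hfb)⟩
  have hlim := tendsto_atTop_ciSup (gagaB_monotone hα hσ) hbdd
  set L := ⨆ k, gagaB α σ z k
  have hL : 0 ≤ L := ge_of_tendsto' hlim (gagaB_nonneg hα hσ)
  have hfL : α * (σ + L) ^ 2 / (z ^ 2 + σ + L) = L := by
    have hden : z ^ 2 + σ + L ≠ 0 := by positivity
    have hnext : Tendsto (fun k => gagaB α σ z (k + 1)) atTop
        (𝓝 (α * (σ + L) ^ 2 / (z ^ 2 + σ + L))) :=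
      (((hlim.const_add σ).pow 2).const_mul α).div (hlim.const_add (z ^ 2 + σ)) hden
    exact tendsto_nhds_unique hnext ((tendsto_add_atTop_iff_nat 1).mpr hlim)
  refine ⟨L, ⟨⟨hL, hfL⟩, fun c hc => ?_⟩, ?_, hlim⟩
  · exact le_of_tendsto' hlim (gagaB_le_of_fixed_point hα hσ hc.1 hc.2)
  · rw [← hfL]
    positivity
end

section
/- For α > 1, σ > 0 and z ∈ ℝ, the GAGA update map f(b) = α(σ+b)²/(z² + σ + b) has a fixed point in [0, ∞) if and only if z² ≥ σ (√α + √(α − 1))². -/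
/-- The discriminant of the fixed-point quadratic, with `p = √α` and `q = √(α - 1)`, factors. -/
lemma gaga_discriminant_eq (p q σ w : ℝ) (hpq : p ^ 2 = q ^ 2 + 1) :
    (w - σ) ^ 2 - 4 * q ^ 2 * σ * w =
      (w - σ * (p + q) ^ 2) * (w - σ * (p - q) ^ 2) := by
  have h : (p + q) * (p - q) = 1 := by linear_combination hpq
  linear_combination (2 * σ * w) * hpq - σ ^ 2 * ((p + q) * (p - q) + 1) * h

/-- In the variable `t = σ + b`, a fixed point is a root of a quadratic. -/
lemma gaga_fixed_point_iff_quadratic {α σ w b : ℝ} (hσ : 0 < σ) (hw : 0 ≤ w) (hb : 0 ≤ b) :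
    α * (σ + b) ^ 2 / (w + σ + b) = b ↔
      (α - 1) * (σ + b) ^ 2 - (w - σ) * (σ + b) + σ * w = 0 := by
  rw [div_eq_iff (by positivity)]
  constructor <;> intro h <;> linear_combination h

/-- For `α > 1`, the GAGA update map `f(b) = α(σ+b)²/(z²+σ+b)` has a fixed point in
`[0, ∞)` iff `z² ≥ σ(√α + √(α−1))²`. -/
theorem gaga_fixed_point_exists_iff (α σ z : ℝ) (hα : 1 < α) (hσ : 0 < σ) :
    (∃ b : ℝ, 0 ≤ b ∧ α * (σ + b) ^ 2 / (z ^ 2 + σ + b) = b) ↔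
      σ * (Real.sqrt α + Real.sqrt (α - 1)) ^ 2 ≤ z ^ 2 := by
  have hp2 : √α ^ 2 = α := Real.sq_sqrt (by linarith)
  have hq2 : √(α - 1) ^ 2 = α - 1 := Real.sq_sqrt (by linarith)
  have hp : 0 < √α := Real.sqrt_pos.2 (by linarith)
  have hq : 0 < √(α - 1) := Real.sqrt_pos.2 (by linarith)
  have hw : 0 ≤ z ^ 2 := sq_nonneg z
  generalize z ^ 2 = w at *
  generalize √α = p at *
  generalize √(α - 1) = q at *
  have hpq : p ^ 2 = q ^ 2 + 1 := by linarith
  have hdisc := gaga_discriminant_eq p q σ w hpq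
  have hqp : q < p := lt_of_pow_lt_pow_left₀ 2 hp.le (by linarith)
  have hsub : σ * (p - q) ^ 2 < σ := by nlinarith [mul_pos hq (sub_pos.2 hqp)]
  have hadd : σ < σ * (p + q) ^ 2 := by nlinarith [mul_pos hp hq, sq_pos_of_pos hq]
  constructor
  · rintro ⟨b, hb, h⟩
    rw [gaga_fixed_point_iff_quadratic hσ hw hb, ← hq2] at h
    have ht : 0 < σ + b := by positivity
    have hσw : σ < w := by
      have : 0 < (w - σ) * (σ + b) := by
        have : 0 < q ^ 2 * (σ + b) ^ 2 + σ * w := by positivity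
        linarith
      linarith [pos_of_mul_pos_left this ht.le]
    have hD : 0 ≤ (w - σ * (p + q) ^ 2) * (w - σ * (p - q) ^ 2) := by
      rw [← hdisc]
      have : (w - σ) ^ 2 - 4 * q ^ 2 * σ * w = (2 * q ^ 2 * (σ + b) - (w - σ)) ^ 2 := by
        linear_combination (-4 * q ^ 2) * h
      rw [this]
      positivity
    exact sub_nonneg.1 (nonneg_of_mul_nonneg_left hD (by linarith))
  · intro h
    have hD : 0 ≤ (w - σ) ^ 2 - 4 * q ^ 2 * σ * w := by
      rw [hdisc]
      exact mul_nonneg (by linarith) (by linarith)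
    obtain ⟨s, hs, hs2⟩ : ∃ s : ℝ, 0 ≤ s ∧ s ^ 2 = (w - σ) ^ 2 - 4 * q ^ 2 * σ * w :=
      ⟨_, Real.sqrt_nonneg _, Real.sq_sqrt hD⟩
    obtain ⟨t, ht⟩ : ∃ t : ℝ, 2 * q ^ 2 * t = w - σ + s :=
      ⟨(w - σ + s) / (2 * q ^ 2), by field_simp⟩
    have ht0 : 0 < t := by
      have : 0 < 2 * q ^ 2 * t := by linarith
      exact pos_of_mul_pos_right this (by positivity)
    have hroot : q ^ 2 * t ^ 2 - (w - σ) * t + σ * w = 0 := by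
      have : 4 * q ^ 2 * (q ^ 2 * t ^ 2 - (w - σ) * t + σ * w) = 0 := by
        linear_combination (2 * q ^ 2 * t - (w - σ) + s) * ht + hs2
      exact (mul_eq_zero.1 this).resolve_left (by positivity)
    have hb : 0 ≤ t - σ := by
      have : (t - σ) * (w + t) = p ^ 2 * t ^ 2 := by
        linear_combination (-t ^ 2) * hpq - hroot
      have hpos : 0 < (t - σ) * (w + t) := by rw [this]; positivity
      exact (pos_of_mul_pos_left hpos (by positivity)).le
    refine ⟨t - σ, hb, ?_⟩
    rw [gaga_fixed_point_iff_quadratic hσ hw hb, ← hq2]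
    linear_combination hroot
end

section
/- For α > 1, σ > 0 and z ∈ ℝ with z² < σ (√α + √(α − 1))², let b_0 = 0, b_{k+1} = α(σ+b_k)²/(z² + σ + b_k) be the GAGA hyperparameter sequence. Then there exists K₀ such that for every K ≥ K₀ the hard truncation condition holds after K iterations, i.e. σ z² < (b_K/α)(σ + b_K/α), so the GAGA output is the zero estimate for all sufficiently many iterations. -/
/-- Below the threshold `σ (√α + √(α - 1))²`, the quadratic governing the increments of the
recursion in the variable `t = σ + b` dominates a positive multiple of `t²`. -/
lemma exists_pos_mul_sq_le_increment {α σ w : ℝ} (hα : 1 < α) (hσ : 0 < σ) (hw : 0 ≤ w)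
    (hwr : w < σ * (Real.sqrt α + Real.sqrt (α - 1)) ^ 2) :
    ∃ δ > 0, ∀ t, 0 ≤ t → δ * t ^ 2 ≤ (α - 1) * t ^ 2 - (w - σ) * t + σ * w := by
  rcases le_or_gt w σ with h | h
  · refine ⟨α - 1, by linarith, fun t ht => ?_⟩
    have h₁ : 0 ≤ (σ - w) * t := mul_nonneg (by linarith) ht
    have h₂ : 0 ≤ σ * w := by positivity
    linarith
  · have hw' : 0 < w := hσ.trans h
    have hp : 0 < σ * w := by positivity
    have ha : Real.sqrt α ^ 2 = α := Real.sq_sqrt (by linarith)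
    have hb : Real.sqrt (α - 1) ^ 2 = α - 1 := Real.sq_sqrt (by linarith)
    have hb₀ : 0 ≤ Real.sqrt (α - 1) := Real.sqrt_nonneg _
    have ha₁ : 1 ≤ Real.sqrt α := Real.one_le_sqrt.2 hα.le
    generalize Real.sqrt α = a at *
    generalize Real.sqrt (α - 1) = b at *
    have hab : (a + b) * (a - b) = 1 := by linear_combination ha - hb
    have hq₀ : 0 < a - b := pos_of_mul_pos_right (hab ▸ one_pos) (by linarith)
    have hq₁ : a - b ≤ 1 := by nlinarith
    have hq : σ * (a - b) ^ 2 < w := by nlinarith [pow_le_one₀ hq₀.le hq₁ (n := 2)]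
    have hdisc : (w - σ) ^ 2 < 4 * (α - 1) * (σ * w) := by
      have hneg : 0 < (σ * (a + b) ^ 2 - w) * (w - σ * (a - b) ^ 2) :=
        mul_pos (by linarith) (by linarith)
      have hprod : (σ * (a + b) ^ 2 - w) * (w - σ * (a - b) ^ 2) =
          4 * (α - 1) * (σ * w) - (w - σ) ^ 2 := by
        linear_combination 2 * σ * w * (ha + hb) - σ ^ 2 * ((a + b) * (a - b) + 1) * hab
      linarith
    refine ⟨(α - 1) - (w - σ) ^ 2 / (4 * (σ * w)), ?_, fun t _ => ?_⟩
    · rw [gt_iff_lt, sub_pos, div_lt_iff₀ (by positivity)]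
      linarith
    · have hsq : 0 ≤ ((w - σ) * t - 2 * (σ * w)) ^ 2 / (4 * (σ * w)) := by positivity
      have hexp : ((w - σ) * t - 2 * (σ * w)) ^ 2 / (4 * (σ * w)) =
          (w - σ) ^ 2 / (4 * (σ * w)) * t ^ 2 - (w - σ) * t + σ * w := by
        field_simp
        ring
      linarith

/-- Below the threshold, the GAGA sequence grows at least linearly. -/
lemma exists_pos_mul_le_gagaB {α σ z : ℝ} (hα : 1 < α) (hσ : 0 < σ)
    (hz : z ^ 2 < σ * (Real.sqrt α + Real.sqrt (α - 1)) ^ 2) :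
    ∃ c > 0, ∀ K : ℕ, c * K ≤ gagaB α σ z K := by
  obtain ⟨δ, hδ, hquad⟩ := exists_pos_mul_sq_le_increment hα hσ (sq_nonneg z) hz
  have hw := sq_nonneg z
  refine ⟨δ * (σ ^ 2 / (z ^ 2 + σ)), by positivity, fun K => ?_⟩
  induction K with
  | zero => simp [gagaB]
  | succ k ih =>
    have hb : 0 ≤ gagaB α σ z k := le_trans (by positivity) ih
    simp only [gagaB]
    push_cast
    generalize gagaB α σ z k = b at *
    have hd : 0 < z ^ 2 + σ + b := by positivity
    have hmono : σ ^ 2 / (z ^ 2 + σ) ≤ (σ + b) ^ 2 / (z ^ 2 + σ + b) := by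
      rw [div_le_div_iff₀ (by positivity) hd]
      have h₁ : 0 ≤ z ^ 2 * (2 * σ * b + b ^ 2) := by positivity
      have h₂ : 0 ≤ σ * b * (σ + b) := by positivity
      linarith
    have hstep : b + δ * ((σ + b) ^ 2 / (z ^ 2 + σ + b)) ≤
        α * (σ + b) ^ 2 / (z ^ 2 + σ + b) := by
      rw [← mul_div_assoc, add_div' _ _ _ hd.ne']
      gcongr
      linarith [hquad (σ + b) (by positivity)]
    have := mul_le_mul_of_nonneg_left hmono hδ.le
    linarith

/-- For `α > 1`, `σ > 0` and `z² < σ(√α + √(α−1))²`, the hard truncation condition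
`σ z² < (b_K/α)(σ + b_K/α)` holds for all sufficiently large iteration counts `K`,
so the GAGA output is the zero estimate. -/
theorem gaga_eventually_truncated (α σ z : ℝ) (hα : 1 < α) (hσ : 0 < σ)
    (hz : z ^ 2 < σ * (Real.sqrt α + Real.sqrt (α - 1)) ^ 2) :
    ∃ K₀ : ℕ, ∀ K ≥ K₀,
      σ * z ^ 2 < (gagaB α σ z K / α) * (σ + gagaB α σ z K / α) ∧
      gagaEst α σ z K = 0 := by
  obtain ⟨c, hc, hgrow⟩ := exists_pos_mul_le_gagaB hα hσ hz
  obtain ⟨K₀, hK₀⟩ := exists_nat_gt (α * z ^ 2 / c)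
  refine ⟨K₀, fun K hK => ?_⟩
  have hα₀ : 0 < α := by linarith
  have hx : z ^ 2 < gagaB α σ z K / α := by
    rw [lt_div_iff₀ hα₀]
    rw [div_lt_iff₀ hc] at hK₀
    have hcast : c * K₀ ≤ c * K := by gcongr
    linarith [hgrow K]
  rw [gagaEst]
  generalize gagaB α σ z K / α = x at *
  have hx₀ : 0 < x := (sq_nonneg z).trans_lt hx
  have hs : 0 < σ + x := by positivity
  have hcond : σ * z ^ 2 < x * (σ + x) := by nlinarith
  refine ⟨hcond, if_pos ?_⟩
  have hrhs : 1 / σ - 1 / (σ + x) = x / (σ * (σ + x)) := by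
    field_simp
    ring
  rw [hrhs, div_pow, div_lt_div_iff₀ (by positivity) (by positivity)]
  have := mul_lt_mul_of_pos_right hcond hs
  linarith
end

section
/- Let σ* > 0 and β* ≠ 0, and for each n ≥ 2 let Z_n be a real Gaussian random variable with mean n σ* β* and variance n σ*, and let (α_n) satisfy the rate condition α ≍ √(log n). Then P( Z_n² ≥ n σ* (√α_n + √(α_n − 1))² ) → 1 as n → ∞. Consequently, the probability that the GAGA update map f(b) = α(σ+b)²/(z²+σ+b) (with σ = nσ*, z = Z_n, α = α_n) has a nonnegative fixed point, so that the GAGA hyperparameter sequence stays bounded, tends to one at a nonzero-coefficient coordinate. -/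
open MeasureTheory ProbabilityTheory Filter
open scoped ENNReal NNReal Topology

/-- Chebyshev's inequality for a real Gaussian law, as a lower bound on the probability of
staying within distance `c` of the mean. -/
theorem one_sub_div_sq_le_gaussianReal_real (m : ℝ) (v : ℝ≥0) {c : ℝ} (hc : 0 < c) :
    1 - v / c ^ 2 ≤ (gaussianReal m v).real {x | |x - m| < c} := by
  have hmeas : MeasurableSet {x : ℝ | c ≤ |x - m|} :=
    measurableSet_le measurable_const (by fun_prop)
  have hcompl : {x : ℝ | |x - m| < c} = {x : ℝ | c ≤ |x - m|}ᶜ := by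
    ext x
    simp
  have hcheb := meas_ge_le_variance_div_sq (μ := gaussianReal m v) (memLp_id_gaussianReal 2) hc
  simp only [id_eq, integral_id_gaussianReal, variance_id_gaussianReal] at hcheb
  have hreal : (gaussianReal m v).real {x | c ≤ |x - m|} ≤ v / c ^ 2 :=
    ENNReal.toReal_le_of_le_ofReal (by positivity) hcheb
  rw [hcompl, probReal_compl_eq_one_sub hmeas]
  linarith

theorem sq_sqrt_add_sqrt_sub_one_le {a : ℝ} (ha : 0 ≤ a) :
    (Real.sqrt a + Real.sqrt (a - 1)) ^ 2 ≤ 4 * a := by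
  have h : Real.sqrt (a - 1) ≤ Real.sqrt a := Real.sqrt_le_sqrt (by linarith)
  nlinarith [Real.sq_sqrt ha, Real.sqrt_nonneg a, Real.sqrt_nonneg (a - 1)]

theorem sqrt_log_natCast_le_sqrt (n : ℕ) :
    Real.sqrt (Real.log n) ≤ Real.sqrt n :=
  Real.sqrt_le_sqrt (Real.log_le_self n.cast_nonneg)

theorem sq_div_four_le_sq_of_abs_sub_lt {x m : ℝ} (h : |x - m| < |m| / 2) :
    m ^ 2 / 4 ≤ x ^ 2 := by
  have hx : |m| / 2 ≤ |x| := by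
    have := abs_sub_abs_le_abs_sub m x
    rw [abs_sub_comm] at this
    linarith
  have := pow_le_pow_left₀ (by positivity) hx 2
  rw [div_pow, sq_abs, sq_abs] at this
  linarith

/-- At a nonzero-coefficient coordinate, with `Z_n ~ N(nσ*β*, nσ*)` and
`α ≍ √(log n)`, the probability that `Z_n² ≥ nσ*(√α_n + √(α_n − 1))²`
(existence of a nonnegative fixed point of the GAGA update map) tends to one. -/
theorem gaga_threshold_prob_nonzero_coefficient
    {Ω : Type*} [MeasurableSpace Ω] (P : Measure Ω) [IsProbabilityMeasure P]
    (σs βs : ℝ) (hσ : 0 < σs) (hβ : βs ≠ 0)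
    (Z : ℕ → Ω → ℝ) (hZmeas : ∀ n, Measurable (Z n))
    (hZ : ∀ n : ℕ, 2 ≤ n →
      P.map (Z n) = gaussianReal ((n : ℝ) * σs * βs) ((n : ℝ) * σs).toNNReal)
    (α : ℕ → ℝ) (c₁ c₂ : ℝ) (hc₁ : 0 < c₁) (hc₂ : 0 < c₂)
    (hα : ∀ n : ℕ, 2 ≤ n →
      c₁ * Real.sqrt (Real.log n) ≤ α n ∧ α n ≤ c₂ * Real.sqrt (Real.log n)) :
    Tendsto
      (fun n : ℕ =>
        (P {ω | (n : ℝ) * σs * (Real.sqrt (α n) + Real.sqrt (α n - 1)) ^ 2 ≤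
          (Z n ω) ^ 2}).toReal)
      atTop (𝓝 1) := by
  have hk : 0 < σs * βs ^ 2 := by positivity
  have hlim : Tendsto (fun n : ℕ => 1 - 4 / (σs * βs ^ 2) / (n : ℝ)) atTop (𝓝 1) := by
    simpa only [sub_zero] using
      (tendsto_const_div_atTop_nhds_zero_nat (4 / (σs * βs ^ 2))).const_sub (1 : ℝ)
  have hsqrt : Tendsto (fun n : ℕ => Real.sqrt n) atTop atTop :=
    Real.tendsto_sqrt_atTop.comp tendsto_natCast_atTop_atTop
  refine tendsto_of_tendsto_of_tendsto_of_le_of_le' hlim tendsto_const_nhds ?_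
    (Eventually.of_forall fun n => measureReal_le_one)
  filter_upwards [eventually_ge_atTop 2,
    hsqrt.eventually_ge_atTop (16 * c₂ / (σs * βs ^ 2))] with n hn hlarge
  have hn0 : (0 : ℝ) < n := by exact_mod_cast (by omega : 0 < n)
  obtain ⟨hαl, hαu⟩ := hα n hn
  have hα0 : 0 ≤ α n := le_trans (by positivity) hαl
  have hαn : 16 * α n ≤ n * (σs * βs ^ 2) := by
    rw [div_le_iff₀ hk] at hlarge
    calc 16 * α n ≤ 16 * c₂ * Real.sqrt n := by
          nlinarith [mul_le_mul_of_nonneg_left (sqrt_log_natCast_le_sqrt n) hc₂.le]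
      _ ≤ Real.sqrt n * (σs * βs ^ 2) * Real.sqrt n := by gcongr
      _ = Real.sqrt n ^ 2 * (σs * βs ^ 2) := by ring
      _ = n * (σs * βs ^ 2) := by rw [Real.sq_sqrt hn0.le]
  set m : ℝ := n * σs * βs with hm
  have hm0 : 0 < |m| / 2 := by positivity
  have hthreshold : n * σs * (Real.sqrt (α n) + Real.sqrt (α n - 1)) ^ 2 ≤ m ^ 2 / 4 := by
    calc n * σs * (Real.sqrt (α n) + Real.sqrt (α n - 1)) ^ 2
        ≤ n * σs * (n * (σs * βs ^ 2) / 4) := by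
          gcongr
          linarith [sq_sqrt_add_sqrt_sub_one_le hα0]
      _ = m ^ 2 / 4 := by rw [hm]; ring
  have hratio : ((n * σs).toNNReal : ℝ) / (|m| / 2) ^ 2 = 4 / (σs * βs ^ 2) / n := by
    rw [Real.coe_toNNReal _ (by positivity), div_pow, sq_abs, hm]
    field_simp
    norm_num
  calc 1 - 4 / (σs * βs ^ 2) / (n : ℝ)
      ≤ (P.map (Z n)).real {x | |x - m| < |m| / 2} := by
        rw [hZ n hn, ← hratio]
        exact one_sub_div_sq_le_gaussianReal_real m _ hm0
    _ = P.real {ω | |Z n ω - m| < |m| / 2} :=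
        map_measureReal_apply (hZmeas n) (measurableSet_lt (by fun_prop) measurable_const)
    _ ≤ P.real {ω | n * σs * (Real.sqrt (α n) + Real.sqrt (α n - 1)) ^ 2 ≤ Z n ω ^ 2} :=
        measureReal_mono fun ω hω =>
          Set.mem_ofPred.2 (hthreshold.trans (sq_div_four_le_sq_of_abs_sub_lt hω))
end
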